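/- arXiv:1503.09056 — 8 statements merged into one kernel-verified Lean document; each statement's English description precedes it below -/
import Mathlib

section
/- Let f : ℝ → ℝ be continuous and set F(s) = ∫₀^s f(t) dt. Assume (H₁): there are s₀ > 0 and M > 0 such that 0 < F(s) ≤ M|f(s)| for all |s| ≥ s₀, and (H₂): 0 < F(s) ≤ (1/2) f(s) s for all s ≠ 0. Then for each ε > 0 there exists s̄_ε > 0 such that F(s) ≤ ε f(s) s for all s with |s| ≥ s̄_ε. -/
open MeasureTheory Real Filter
open scoped Topology

/-- `primF f s = ∫₀^s f(t) dt`. -/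
noncomputable def primF (f : ℝ → ℝ) (s : ℝ) : ℝ := ∫ t in (0:ℝ)..s, f t

/-- under (H₁) and (H₂), for every `ε > 0` there is `s̄_ε > 0` such that
`F(s) ≤ ε f(s) s` for all `|s| ≥ s̄_ε`. -/
theorem F_le_eps_fs
    (f : ℝ → ℝ) (hf : Continuous f)
    (hH1 : ∃ s₀ > 0, ∃ M > 0, ∀ s : ℝ, s₀ ≤ |s| → 0 < primF f s ∧ primF f s ≤ M * |f s|)
    (hH2 : ∀ s : ℝ, s ≠ 0 → 0 < primF f s ∧ primF f s ≤ (1/2) * f s * s) :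
    ∀ ε > 0, ∃ sε > 0, ∀ s : ℝ, sε ≤ |s| → primF f s ≤ ε * (f s * s) := by
  obtain ⟨s₀, hs₀, M, hM, hF⟩ := hH1
  intro ε hε
  refine ⟨max s₀ (M / ε), lt_max_of_lt_left hs₀, fun s hs => ?_⟩
  have hs₀s : s₀ ≤ |s| := (le_max_left _ _).trans hs
  have hMs : M ≤ ε * |s| := (div_le_iff₀' hε).mp ((le_max_right _ _).trans hs)
  obtain ⟨hpos, hle⟩ := hH2 s (abs_pos.mp (hs₀.trans_le hs₀s))
  have hfs : |f s| * |s| = f s * s := by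
    rw [← abs_mul, abs_of_nonneg (by linarith)]
  calc primF f s ≤ M * |f s| := (hF s hs₀s).2
    _ ≤ ε * |s| * |f s| := by gcongr
    _ = ε * (f s * s) := by rw [← hfs]; ring
end

section
/- Let f : ℝ → ℝ be continuous, set F(s) = ∫₀^s f(t) dt, and let p > 2 and s̄ > 0 be such that F(s̄) > 0 and p·F(s) ≤ f(s)·s for all s ≥ s̄. Then there exist constants C₁ > 0 and C₂ > 0 such that F(s) ≥ C₁ s^p − C₂ for all s ≥ 0. -/
open MeasureTheory Real Filter
open scoped Topology

theorem hasDerivAt_primF {f : ℝ → ℝ} (hf : Continuous f) (s : ℝ) :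
    HasDerivAt (primF f) (f s) s :=
  intervalIntegral.integral_hasDerivAt_right (hf.intervalIntegrable _ _)
    (hf.stronglyMeasurableAtFilter _ _) hf.continuousAt

/-- If `p F(s) ≤ F'(s) s` for `s ≥ a > 0`, then `F(s) s^(-p)` is nondecreasing on `[a, ∞)`. -/
theorem monotoneOn_mul_rpow_neg {F f : ℝ → ℝ} {p a : ℝ} (ha : 0 < a)
    (hF : ∀ s, a ≤ s → HasDerivAt F (f s) s) (h : ∀ s, a ≤ s → p * F s ≤ f s * s) :
    MonotoneOn (fun s => F s * s ^ (-p)) (Set.Ici a) := by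
  have hderiv : ∀ s, a ≤ s → HasDerivAt (fun s => F s * s ^ (-p))
      (f s * s ^ (-p) + F s * (-p * s ^ (-p - 1))) s := fun s hs =>
    (hF s hs).mul (hasDerivAt_rpow_const (Or.inl (ha.trans_le hs).ne'))
  refine monotoneOn_of_deriv_nonneg (convex_Ici a)
    (fun s hs => (hderiv s hs).continuousAt.continuousWithinAt)
    (fun s hs => (hderiv s (interior_subset hs)).differentiableAt.differentiableWithinAt) ?_
  intro s hs
  have has : a ≤ s := interior_subset hs
  have hs0 : 0 < s := ha.trans_le has
  have hpow : s ^ (-p) = s ^ (-p - 1) * s := by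
    rw [← rpow_add_one hs0.ne', sub_add_cancel]
  rw [(hderiv s has).deriv, hpow]
  have := mul_nonneg (rpow_nonneg hs0.le (-p - 1)) (sub_nonneg.2 (h s has))
  linarith

/-- if `p > 2`, `F(s̄) > 0` and `p F(s) ≤ f(s) s` for `s ≥ s̄`, then
`F(s) ≥ C₁ s^p − C₂` for all `s ≥ 0`. -/
theorem F_superquadratic_lower_bound
    (f : ℝ → ℝ) (hf : Continuous f) (p sb : ℝ) (hp : 2 < p) (hsb : 0 < sb)
    (hFsb : 0 < primF f sb)
    (hAR : ∀ s : ℝ, sb ≤ s → p * primF f s ≤ f s * s) :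
    ∃ C₁ > 0, ∃ C₂ > 0, ∀ s : ℝ, 0 ≤ s → C₁ * s ^ p - C₂ ≤ primF f s := by
  have hcont : Continuous (primF f) :=
    continuous_iff_continuousAt.2 fun s => (hasDerivAt_primF hf s).continuousAt
  have hmono := monotoneOn_mul_rpow_neg hsb (fun s _ => hasDerivAt_primF hf s) hAR
  obtain ⟨m, hm⟩ := (isCompact_Icc (a := 0) (b := sb)).bddBelow_image hcont.continuousOn
  have hC₁ : 0 < primF f sb * sb ^ (-p) := mul_pos hFsb (rpow_pos_of_pos hsb _)
  refine ⟨_, hC₁, primF f sb + |m|, by positivity, fun s hs => ?_⟩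
  rcases le_total s sb with h | h
  · have hms : m ≤ primF f s := hm ⟨s, ⟨hs, h⟩, rfl⟩
    have hle : primF f sb * sb ^ (-p) * s ^ p ≤ primF f sb * sb ^ (-p) * sb ^ p :=
      mul_le_mul_of_nonneg_left (rpow_le_rpow hs h (by linarith)) hC₁.le
    rw [mul_assoc _ _ (sb ^ p), ← rpow_add hsb, neg_add_cancel, rpow_zero, mul_one] at hle
    linarith [neg_abs_le m]
  · have hs0 : 0 < s := hsb.trans_le h
    have hle : primF f sb * sb ^ (-p) * s ^ p ≤ primF f s * s ^ (-p) * s ^ p :=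
      mul_le_mul_of_nonneg_right (hmono Set.self_mem_Ici h h) (rpow_nonneg hs _)
    rw [mul_assoc (primF f s), ← rpow_add hs0, neg_add_cancel, rpow_zero, mul_one] at hle
    linarith [abs_nonneg m]
end

section
/- Let f : ℝ → ℝ be continuous and satisfy: (f₁) there is C₀ > 0 with |f(s)| ≤ C₀·exp(4π s²) for all s ∈ ℝ, and (f₂) lim_{s→0} f(s)/s = 0. Set F(s) = ∫₀^s f(t) dt. Then for every ε > 0, every q ≥ 1, and every β > 4π, there exists a constant C > 0 such that |F(s)| ≤ (ε/2) s² + C |s|^q exp(β s²) for all s ∈ ℝ. -/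
open MeasureTheory Real Filter
open scoped Topology

/-- A continuous function that is `o(s)` on the punctured neighbourhoods of `0` vanishes at `0`. -/
theorem eq_zero_of_tendsto_div {f : ℝ → ℝ} (hf : Continuous f)
    (h : Tendsto (fun s : ℝ => f s / s) (𝓝[≠] 0) (𝓝 0)) : f 0 = 0 := by
  have hid : Tendsto (fun s : ℝ => s) (𝓝[≠] 0) (𝓝 0) := tendsto_id.mono_left nhdsWithin_le_nhds
  have hmul : Tendsto (fun s : ℝ => f s / s * s) (𝓝[≠] 0) (𝓝 0) := by
    simpa using h.mul hid
  refine tendsto_nhds_unique ((hf.tendsto 0).mono_left nhdsWithin_le_nhds) (hmul.congr' ?_)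
  filter_upwards [self_mem_nhdsWithin] with s hs
  exact div_mul_cancel₀ _ hs

/-- A bound for `|f|` on `[-|s|, |s|]` gives a bound for `|primF f s|`. -/
theorem abs_primF_le {f : ℝ → ℝ} {s M : ℝ} (h : ∀ t, |t| ≤ |s| → |f t| ≤ M) :
    |primF f s| ≤ M * |s| := by
  have := intervalIntegral.norm_integral_le_of_norm_le_const (a := 0) (b := s) (f := f) (C := M)
    fun t ht => h t (by
      simpa using Set.abs_sub_left_of_mem_uIcc (Set.uIoc_subset_uIcc ht))
  simpa [primF] using this

/-- under (f₁) and (f₂), for every `ε > 0`, `q ≥ 1`, `β > 4π`, there is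
`C > 0` with `|F(s)| ≤ (ε/2) s² + C |s|^q exp(β s²)` for all `s`. -/
theorem F_growth_estimate
    (f : ℝ → ℝ) (hf : Continuous f)
    (hf1 : ∃ C₀ > 0, ∀ s : ℝ, |f s| ≤ C₀ * Real.exp (4 * π * s ^ 2))
    (hf2 : Tendsto (fun s : ℝ => f s / s) (𝓝[≠] 0) (𝓝 0)) :
    ∀ ε > 0, ∀ q : ℝ, 1 ≤ q → ∀ β : ℝ, 4 * π < β →
      ∃ C > 0, ∀ s : ℝ,
        |primF f s| ≤ (ε / 2) * s ^ 2 + C * |s| ^ q * Real.exp (β * s ^ 2) := by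
  intro ε hε q hq β hβ
  obtain ⟨C₀, hC₀, hbound⟩ := hf1
  have hf0 := eq_zero_of_tendsto_div hf hf2
  have hlocal : ∃ δ > 0, ∀ t : ℝ, |t| < δ → |f t| ≤ ε / 2 * |t| := by
    obtain ⟨δ, hδ, h⟩ := Metric.tendsto_nhdsWithin_nhds.1 hf2 (ε / 2) (half_pos hε)
    refine ⟨δ, hδ, fun t ht => ?_⟩
    rcases eq_or_ne t 0 with rfl | ht0
    · simp [hf0]
    · have hlt := h (Set.mem_compl_singleton_iff.2 ht0) (by simpa using ht)
      rw [dist_zero_right, Real.norm_eq_abs, abs_div, div_lt_iff₀ (abs_pos.2 ht0)] at hlt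
      exact hlt.le
  obtain ⟨δ, hδ, hsmall⟩ := hlocal
  refine ⟨C₀ * δ ^ (1 - q), by positivity, fun s => ?_⟩
  rcases lt_or_ge |s| δ with hs | hs
  · calc |primF f s| ≤ ε / 2 * |s| * |s| :=
          abs_primF_le fun t ht => (hsmall t (ht.trans_lt hs)).trans (by gcongr)
      _ = ε / 2 * s ^ 2 := by rw [mul_assoc, abs_mul_abs_self, sq]
      _ ≤ _ := le_add_of_nonneg_right (by positivity)
  · have hs0 : 0 < |s| := hδ.trans_le hs
    have hpow : |s| ≤ δ ^ (1 - q) * |s| ^ q :=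
      calc |s| = |s| ^ (1 - q) * |s| ^ q := by rw [← Real.rpow_add hs0]; simp
        _ ≤ δ ^ (1 - q) * |s| ^ q :=
          mul_le_mul_of_nonneg_right (Real.rpow_le_rpow_of_nonpos hδ hs (sub_nonpos.2 hq))
            (by positivity)
    calc |primF f s| ≤ C₀ * Real.exp (4 * π * s ^ 2) * |s| :=
          abs_primF_le fun t ht => (hbound t).trans (by
            have := sq_le_sq.2 ht
            gcongr)
      _ ≤ C₀ * Real.exp (β * s ^ 2) * (δ ^ (1 - q) * |s| ^ q) := by gcongr
      _ = C₀ * δ ^ (1 - q) * |s| ^ q * Real.exp (β * s ^ 2) := by ring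
      _ ≤ _ := le_add_of_nonneg_left (by positivity)
end

section
/- Let f : ℝ → ℝ be a continuous odd function satisfying (f₁): there is C > 0 with |f(s)| ≤ C·exp(4π s²) for all s ∈ ℝ, and (f₂): lim_{s→0} f(s)/s = 0. Fix m ∈ ℕ, m ≥ 1, and let A_m = { x = (x₁,x₂) ∈ B : cos(π/2^m)·|x₁| < sin(π/2^m)·x₂ }, where B is the open unit ball of ℝ². For u : ℝ² → ℝ smooth with compact support in A_m, set I(u) = (1/2)∫_{A_m} ‖∇u‖² − ∫_{A_m} F(u), where F(s) = ∫₀^s f(t) dt. Then there exist r > 0 and ρ > 0 such that I(u) ≥ ρ for every smooth u with compact support in A_m satisfying ∫_{A_m} ‖∇u‖² = r². -/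
open MeasureTheory Real Filter Metric Set
open scoped Topology RealInnerProductSpace

/-- The angular sector `A_m = {x ∈ B : cos(π/2^m)·|x₁| < sin(π/2^m)·x₂}` of the
open unit ball `B ⊂ ℝ²`. -/
def sector (m : ℕ) : Set (EuclideanSpace ℝ (Fin 2)) :=
  {x | x ∈ ball (0 : EuclideanSpace ℝ (Fin 2)) 1 ∧
    Real.cos (π / 2 ^ m) * |x 0| < Real.sin (π / 2 ^ m) * x 1}

/-- The energy functional `I(u) = (1/2)∫_{A_m} ‖∇u‖² − ∫_{A_m} F(u)`. -/
noncomputable def energy (f : ℝ → ℝ) (m : ℕ) (u : EuclideanSpace ℝ (Fin 2) → ℝ) : ℝ :=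
  (1/2) * (∫ x in sector m, ‖gradient u x‖ ^ 2) - ∫ x in sector m, primF f (u x)

open scoped ENNReal

theorem lintegral_euclidean_polar {G : EuclideanSpace ℝ (Fin 2) → ℝ≥0∞} (hG : Measurable G) :
    ∫⁻ y, G y = ∫⁻ θ in Ioo (-π) π, ∫⁻ ρ in Ioi (0 : ℝ),
      ENNReal.ofReal ρ * G (ρ • !₂[Real.cos θ, Real.sin θ]) := by
  have h1 : MeasurePreserving
      (fun p : ℝ × ℝ => WithLp.toLp 2 ((MeasurableEquiv.finTwoArrow (α := ℝ)).symm p))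
      volume volume :=
    (PiLp.volume_preserving_toLp (Fin 2)).comp (volume_preserving_finTwoArrow ℝ).symm
  have hm : Measurable fun p : ℝ × ℝ =>
      ENNReal.ofReal p.1 * G (p.1 • !₂[Real.cos p.2, Real.sin p.2]) := by
    have : Continuous fun p : ℝ × ℝ => p.1 • !₂[Real.cos p.2, Real.sin p.2] := by fun_prop
    exact (by fun_prop : Measurable fun p : ℝ × ℝ => ENNReal.ofReal p.1).mul
      (hG.comp this.measurable)
  rw [← h1.lintegral_comp hG, ← lintegral_comp_polarCoord_symm]
  have hset : polarCoord.target = Ioi (0 : ℝ) ×ˢ Ioo (-π) π := rfl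
  rw [hset, Measure.volume_eq_prod, ← Measure.prod_restrict]
  rw [← lintegral_prod_symm' _ hm]
  refine lintegral_congr fun p => ?_
  rw [smul_eq_mul]
  congr 2
  ext i
  fin_cases i <;> simp [MeasurableEquiv.finTwoArrow, polarCoord_symm_apply]

theorem norm_cos_sin (θ : ℝ) : ‖!₂[Real.cos θ, Real.sin θ]‖ = 1 := by
  simp [EuclideanSpace.norm_eq]

theorem two_pi_mul_enorm_le {v : EuclideanSpace ℝ (Fin 2) → ℝ} (hv : ContDiff ℝ 1 v)
    (hc : HasCompactSupport v) (x : EuclideanSpace ℝ (Fin 2)) :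
    ENNReal.ofReal (2 * π) * ‖v x‖ₑ ≤ ∫⁻ y, ‖fderiv ℝ v y‖ₑ * ‖y - x‖ₑ⁻¹ := by
  have hray : ∀ θ : ℝ, ‖v x‖ₑ ≤
      ∫⁻ ρ in Ioi (0 : ℝ), ‖fderiv ℝ v (x + ρ • !₂[Real.cos θ, Real.sin θ])‖ₑ := by
    intro θ
    set e := !₂[Real.cos θ, Real.sin θ] with he
    have hn : ‖e‖ = 1 := norm_cos_sin θ
    have hemb : Topology.IsClosedEmbedding fun t : ℝ => x + (-t) • e := by
      refine Isometry.isClosedEmbedding (Isometry.of_dist_eq fun a b => ?_)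
      rw [dist_add_left, dist_eq_norm, ← sub_smul, norm_smul, hn, Real.dist_eq, Real.norm_eq_abs,
        mul_one, ← abs_neg]
      ring_nf
    have hf : ContDiff ℝ 1 fun t : ℝ => v (x + (-t) • e) := by fun_prop
    have := HasCompactSupport.enorm_le_lintegral_Ici_deriv hf (hc.comp_isClosedEmbedding hemb) 0
    simp only [neg_zero, zero_smul, add_zero] at this
    refine this.trans ?_
    have hb : ∀ t : ℝ, ‖deriv (fun t : ℝ => v (x + (-t) • e)) t‖ₑ ≤
        ‖fderiv ℝ v (x + (-t) • e)‖ₑ := by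
      intro t
      have hd : HasDerivAt (fun t : ℝ => x + (-t) • e) ((-1 : ℝ) • e) t :=
        ((hasDerivAt_neg t).smul_const e).const_add x
      have h2 := ((hv.differentiable one_ne_zero) (x + (-t) • e)).hasFDerivAt.comp_hasDerivAt t hd
      rw [show deriv (fun t : ℝ => v (x + (-t) • e)) t = _ from h2.deriv]
      refine (ContinuousLinearMap.le_opENorm _ _).trans ?_
      rw [enorm_smul, ← ofReal_norm e, hn]
      simp
    refine (lintegral_mono hb).trans (le_of_eq ?_)
    rw [← setLIntegral_congr (Iio_ae_eq_Iic (a := (0 : ℝ)) (μ := volume))]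
    have := (Measure.measurePreserving_neg (volume : Measure ℝ)).setLIntegral_comp_preimage_emb
      (MeasurableEquiv.neg ℝ).measurableEmbedding
      (fun ρ => ‖fderiv ℝ v (x + ρ • e)‖ₑ) (Ioi 0)
    simpa using this
  have hcd : Continuous (fderiv ℝ v) := hv.continuous_fderiv one_ne_zero
  have htr : ∫⁻ y, ‖fderiv ℝ v y‖ₑ * ‖y - x‖ₑ⁻¹ =
      ∫⁻ z, ‖fderiv ℝ v (x + z)‖ₑ * ‖z‖ₑ⁻¹ := by
    rw [← lintegral_add_left_eq_self _ x]
    simp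
  rw [htr, lintegral_euclidean_polar (by fun_prop)]
  calc ENNReal.ofReal (2 * π) * ‖v x‖ₑ = ∫⁻ θ in Ioo (-π) π, ‖v x‖ₑ := by
        rw [setLIntegral_const, Real.volume_Ioo, mul_comm]; ring_nf
    _ ≤ _ := lintegral_mono fun θ => (hray θ).trans ?_
  refine setLIntegral_mono' measurableSet_Ioi fun ρ hρ => ?_
  have hρ' : (0 : ℝ) < ρ := hρ
  rw [enorm_smul, ← ofReal_norm !₂[_, _], norm_cos_sin, ENNReal.ofReal_one, mul_one,
    mul_left_comm, Real.enorm_eq_ofReal hρ'.le, ENNReal.mul_inv_cancel (by simpa) (by simp),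
    mul_one]

/-- The kernel `1 / ‖z‖` restricted to the disc of radius two. -/
noncomputable def discKernel (z : EuclideanSpace ℝ (Fin 2)) : ℝ≥0∞ :=
  (ball 0 2).indicator (fun z => ‖z‖ₑ⁻¹) z

theorem measurable_discKernel : Measurable discKernel :=
  (by fun_prop : Measurable fun z : EuclideanSpace ℝ (Fin 2) => ‖z‖ₑ⁻¹).indicator
    measurableSet_ball

theorem lintegral_discKernel_rpow {b : ℝ} (hb : 0 < b) (hb2 : b < 2) :
    ∫⁻ z, discKernel z ^ b = ENNReal.ofReal (2 * π * (2 ^ (2 - b) / (2 - b))) := by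
  rw [lintegral_euclidean_polar (measurable_discKernel.pow_const b)]
  have hin : ∀ θ : ℝ, ∫⁻ ρ in Ioi (0 : ℝ),
      ENNReal.ofReal ρ * discKernel (ρ • !₂[Real.cos θ, Real.sin θ]) ^ b =
      ENNReal.ofReal (2 ^ (2 - b) / (2 - b)) := by
    intro θ
    have h1 : ∀ ρ ∈ Ioi (0 : ℝ),
        ENNReal.ofReal ρ * discKernel (ρ • !₂[Real.cos θ, Real.sin θ]) ^ b =
        (Iio (2 : ℝ)).indicator (fun ρ => ENNReal.ofReal (ρ ^ (1 - b))) ρ := by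
      intro ρ hρ
      have hρ' : (0 : ℝ) < ρ := hρ
      have hn : ‖ρ • !₂[Real.cos θ, Real.sin θ]‖ = ρ := by
        rw [norm_smul, norm_cos_sin, mul_one, Real.norm_of_nonneg hρ'.le]
      by_cases h2 : ρ < 2
      · rw [discKernel, indicator_of_mem (by simpa [hn] using h2), indicator_of_mem (by exact h2),
          ← ofReal_norm, hn, ← ENNReal.ofReal_inv_of_pos hρ',
          ENNReal.ofReal_rpow_of_pos (inv_pos.2 hρ'), ← ENNReal.ofReal_mul hρ'.le,
          Real.inv_rpow hρ'.le, Real.rpow_sub hρ', Real.rpow_one, div_eq_mul_inv]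
      · rw [discKernel, indicator_of_notMem (by simpa [hn] using h2),
          indicator_of_notMem (by exact h2), ENNReal.zero_rpow_of_pos hb, mul_zero]
    rw [setLIntegral_congr_fun measurableSet_Ioi h1, lintegral_indicator measurableSet_Iio,
      Measure.restrict_restrict measurableSet_Iio, inter_comm, Ioi_inter_Iio]
    have hi : IntervalIntegrable (fun ρ : ℝ => ρ ^ (1 - b)) volume 0 2 :=
      intervalIntegral.intervalIntegrable_rpow' (by linarith)
    rw [intervalIntegrable_iff_integrableOn_Ioo_of_le zero_le_two] at hi
    rw [← ofReal_integral_eq_lintegral_ofReal hi, ← integral_Ioc_eq_integral_Ioo,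
      ← intervalIntegral.integral_of_le zero_le_two, integral_rpow (Or.inl (by linarith))]
    · rw [Real.zero_rpow (by linarith)]; ring_nf
    · filter_upwards [ae_restrict_mem measurableSet_Ioo] with ρ hρ
      exact Real.rpow_nonneg hρ.1.le _
  simp_rw [hin]
  rw [setLIntegral_const, Real.volume_Ioo, mul_comm, ← ENNReal.ofReal_mul (by linarith [pi_pos])]
  ring_nf

theorem lintegral_mul_pow_two_mul_le {α : Type*} [MeasurableSpace α] {μ : Measure α}
    {G N : α → ℝ≥0∞} (hG : Measurable G) (hN : Measurable N) {k : ℕ} (hk : 1 ≤ k) :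
    (∫⁻ y, G y * N y ∂μ) ^ (2 * k) ≤ (∫⁻ y, G y ^ 2 ∂μ) ^ (k - 1) *
      (∫⁻ y, G y ^ 2 * N y ∂μ) * (∫⁻ y, N y ^ (2 - 1 / k : ℝ) ∂μ) ^ k := by
  have hk' : (1 : ℝ) ≤ k := by exact_mod_cast hk
  have hk0 : (0 : ℝ) < k := by linarith
  have hk1 : 1 / (k : ℝ) ≤ 1 := by rw [div_le_one hk0]; exact hk'
  have hkp : 0 < 1 / (k : ℝ) := by positivity
  have H := ENNReal.lintegral_prod_norm_pow_le (μ := μ) Finset.univ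
    (f := ![fun y => G y ^ 2, fun y => G y ^ 2 * N y, fun y => N y ^ (2 - 1 / k : ℝ)])
    (p := ![(1 - 1 / k) / 2, 1 / k / 2, 1 / 2])
    (by
      intro i _
      fin_cases i
      · exact (hG.pow_const 2).aemeasurable
      · exact ((hG.pow_const 2).mul hN).aemeasurable
      · exact (hN.pow_const _).aemeasurable)
    (by simp [Fin.sum_univ_three]; ring)
    (by
      intro i _
      fin_cases i
      · exact div_nonneg (sub_nonneg.2 hk1) zero_le_two
      · exact div_nonneg hkp.le zero_le_two
      · exact one_half_pos.le)
  simp only [Fin.prod_univ_three, Matrix.cons_val_zero, Matrix.cons_val_one, Matrix.cons_val] at H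
  have hsplit : ∀ y, (G y ^ 2) ^ ((1 - 1 / k) / 2 : ℝ) * (G y ^ 2 * N y) ^ (1 / k / 2 : ℝ) *
      (N y ^ (2 - 1 / k : ℝ)) ^ (1 / 2 : ℝ) = G y * N y := by
    intro y
    rw [ENNReal.mul_rpow_of_nonneg _ _ (by positivity), ← mul_assoc,
      ← ENNReal.rpow_add_of_nonneg _ _ (by linarith) (by positivity), ← ENNReal.rpow_mul, mul_assoc,
      ← ENNReal.rpow_add_of_nonneg _ _ (by positivity) (by linarith), ← ENNReal.rpow_natCast,
      ← ENNReal.rpow_mul]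
    rw [show ((2 : ℕ) : ℝ) * ((1 - 1 / k) / 2 + 1 / k / 2) = 1 by push_cast; ring,
      show (1 / k / 2 + (2 - 1 / k) * (1 / 2) : ℝ) = 1 by ring, ENNReal.rpow_one, ENNReal.rpow_one]
  simp_rw [hsplit] at H
  refine (pow_le_pow_left' H (2 * k)).trans (le_of_eq ?_)
  rw [mul_pow, mul_pow]
  simp_rw [← ENNReal.rpow_natCast, ← ENNReal.rpow_mul]
  rw [show ((1 - 1 / k) / 2 * ((2 * k : ℕ) : ℝ) : ℝ) = ((k - 1 : ℕ) : ℝ) by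
      push_cast [Nat.cast_sub hk]; field_simp,
    show (1 / k / 2 * ((2 * k : ℕ) : ℝ) : ℝ) = 1 by push_cast; field_simp,
    show (1 / 2 * ((2 * k : ℕ) : ℝ) : ℝ) = k by push_cast; ring, ENNReal.rpow_one]

theorem lintegral_discKernel_rpow_le {k : ℕ} (hk : 1 ≤ k) :
    ∫⁻ z, discKernel z ^ (2 - 1 / k : ℝ) ≤ ENNReal.ofReal (4 * π * k) := by
  have hk' : (1 : ℝ) ≤ k := by exact_mod_cast hk
  have hk0 : (0 : ℝ) < k := by linarith
  have hk1 : 1 / (k : ℝ) ≤ 1 := by rw [div_le_one hk0]; exact hk'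
  have hkp : 0 < 1 / (k : ℝ) := by positivity
  rw [lintegral_discKernel_rpow (by linarith) (by linarith)]
  refine ENNReal.ofReal_le_ofReal ?_
  have h2 : (2 : ℝ) ^ (1 / k : ℝ) ≤ 2 := by
    simpa using Real.rpow_le_rpow_of_exponent_le one_le_two hk1
  rw [show (2 : ℝ) - (2 - 1 / k) = 1 / k by ring, div_div_eq_mul_div, div_one]
  nlinarith [mul_le_mul_of_nonneg_right h2 (mul_nonneg pi_pos.le hk0.le)]

theorem lintegral_enorm_pow_two_mul_le {v : EuclideanSpace ℝ (Fin 2) → ℝ} (hv : ContDiff ℝ 1 v)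
    (hs : tsupport v ⊆ ball 0 1) {k : ℕ} (hk : 1 ≤ k) :
    ∫⁻ x, ‖v x‖ₑ ^ (2 * k) ≤ ENNReal.ofReal (4 * π) *
      (ENNReal.ofReal (k / π) * ∫⁻ y, ‖fderiv ℝ v y‖ₑ ^ 2) ^ k := by
  have hc : HasCompactSupport v := (isCompact_closedBall 0 1).of_isClosed_subset
    (isClosed_tsupport v) (hs.trans ball_subset_closedBall)
  have hcd : Continuous (fderiv ℝ v) := hv.continuous_fderiv one_ne_zero
  have hN := measurable_discKernel
  set R := ∫⁻ y, ‖fderiv ℝ v y‖ₑ ^ 2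
  have hrep : ∀ x, ENNReal.ofReal (2 * π) * ‖v x‖ₑ ≤
      ∫⁻ y, ‖fderiv ℝ v y‖ₑ * discKernel (y - x) := by
    intro x
    by_cases hx : x ∈ tsupport v
    · refine (two_pi_mul_enorm_le hv hc x).trans (lintegral_mono fun y => ?_)
      by_cases hy : y ∈ tsupport v
      · have : y - x ∈ ball (0 : EuclideanSpace ℝ (Fin 2)) 2 := by
          have h1 := mem_ball_zero_iff.1 (hs hx)
          have h2 := mem_ball_zero_iff.1 (hs hy)
          rw [mem_ball_zero_iff]
          linarith [norm_sub_le y x]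
        rw [discKernel, indicator_of_mem this]
      · have : ‖fderiv ℝ v y‖ₑ = 0 := by
          rw [← ofReal_norm, Function.notMem_support.1 fun h => hy (support_fderiv_subset ℝ h),
            norm_zero, ENNReal.ofReal_zero]
        rw [this, zero_mul, zero_mul]
    · simp [image_eq_zero_of_notMem_tsupport hx]
  have hpt : ∀ x, ENNReal.ofReal (2 * π) ^ (2 * k) * ‖v x‖ₑ ^ (2 * k) ≤
      R ^ (k - 1) * ENNReal.ofReal (4 * π * k) ^ k *
        ∫⁻ y, ‖fderiv ℝ v y‖ₑ ^ 2 * discKernel (y - x) := by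
    intro x
    rw [← mul_pow]
    refine (pow_le_pow_left' (hrep x) _).trans ((lintegral_mul_pow_two_mul_le (by fun_prop)
      (hN.comp (measurable_id.sub_const x)) hk).trans ?_)
    rw [mul_right_comm]
    refine mul_le_mul' (mul_le_mul_right (pow_le_pow_left' ?_ k) _) le_rfl
    simp only [Function.comp_def, id_eq]
    rw [lintegral_sub_right_eq_self (fun z => discKernel z ^ (2 - 1 / k : ℝ)) x]
    exact lintegral_discKernel_rpow_le hk
  have hmeas2 : Measurable (Function.uncurry fun x y : EuclideanSpace ℝ (Fin 2) =>
      ‖fderiv ℝ v y‖ₑ ^ 2 * discKernel (y - x)) :=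
    (by fun_prop : Measurable fun p : EuclideanSpace ℝ (Fin 2) × EuclideanSpace ℝ (Fin 2) =>
      ‖fderiv ℝ v p.2‖ₑ ^ 2).mul (hN.comp (measurable_snd.sub measurable_fst))
  have hfub : ∫⁻ x, ∫⁻ y, ‖fderiv ℝ v y‖ₑ ^ 2 * discKernel (y - x) =
      R * ENNReal.ofReal (4 * π) := by
    rw [lintegral_lintegral_swap hmeas2.aemeasurable]
    have : ∀ y, ∫⁻ x, ‖fderiv ℝ v y‖ₑ ^ 2 * discKernel (y - x) =
        ‖fderiv ℝ v y‖ₑ ^ 2 * ENNReal.ofReal (4 * π) := by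
      intro y
      rw [lintegral_const_mul _ (show Measurable fun x => discKernel (y - x) from
        hN.comp (measurable_id'.const_sub y)),
        
        lintegral_sub_left_eq_self discKernel y]
      have := lintegral_discKernel_rpow one_pos one_lt_two
      simp only [ENNReal.rpow_one] at this
      rw [this]
      congr 2
      norm_num
      ring
    simp_rw [this]
    rw [lintegral_mul_const _ (by fun_prop)]
  have hint := lintegral_mono (μ := volume) hpt
  rw [lintegral_const_mul _ (by have := hv.continuous; fun_prop),
    lintegral_const_mul _ hmeas2.lintegral_prod_right, hfub] at hint
  have h2π : ENNReal.ofReal (2 * π) ^ (2 * k) ≠ 0 :=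
    pow_ne_zero _ (by simpa using pi_pos)
  have h2π' : ENNReal.ofReal (2 * π) ^ (2 * k) ≠ ∞ := ENNReal.pow_ne_top ENNReal.ofReal_ne_top
  refine (ENNReal.mul_le_mul_iff_right h2π h2π').1 (hint.trans (le_of_eq ?_))
  have hk4 : ENNReal.ofReal (4 * π * k) = ENNReal.ofReal (2 * π) ^ 2 * ENNReal.ofReal (k / π) := by
    rw [← ENNReal.ofReal_pow (by positivity), ← ENNReal.ofReal_mul (by positivity)]
    congr 1
    field_simp
    ring
  rw [hk4]
  obtain ⟨j, rfl⟩ := Nat.exists_eq_add_of_le' hk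
  simp only [Nat.add_sub_cancel]
  ring

theorem hasSum_exp_sub_one_sub (y : ℝ) :
    HasSum (fun j : ℕ => y ^ (j + 2) / (j + 2).factorial) (Real.exp y - 1 - y) := by
  have h := NormedSpace.expSeries_div_hasSum_exp y
  rw [← Real.exp_eq_exp_ℝ] at h
  have := (hasSum_nat_add_iff' 2).2 h
  simpa [Finset.sum_range_succ, sub_sub] using this

theorem lintegral_exp_sub_one_sub_le {v : EuclideanSpace ℝ (Fin 2) → ℝ} (hv : ContDiff ℝ 1 v)
    (hs : tsupport v ⊆ ball 0 1) {d : ℝ} (hd : 0 ≤ d)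
    (hvd : ∫⁻ y, ‖fderiv ℝ v y‖ₑ ^ 2 = ENNReal.ofReal d)
    (hq : 8 * Real.exp 1 * d ≤ 1 / 2) :
    ∫⁻ x, ENNReal.ofReal (Real.exp (8 * π * v x ^ 2) - 1 - 8 * π * v x ^ 2) ≤
      ENNReal.ofReal (8 * π * (8 * Real.exp 1 * d) ^ 2) := by
  have hvc := hv.continuous
  have hterm : ∀ x, ENNReal.ofReal (Real.exp (8 * π * v x ^ 2) - 1 - 8 * π * v x ^ 2) =
      ∑' j : ℕ, ENNReal.ofReal ((8 * π) ^ (j + 2) / (j + 2).factorial) *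
        ‖v x‖ₑ ^ (2 * (j + 2)) := by
    intro x
    have h := hasSum_exp_sub_one_sub (8 * π * v x ^ 2)
    rw [← h.tsum_eq, ENNReal.ofReal_tsum_of_nonneg (fun j => by positivity) h.summable]
    refine tsum_congr fun j => ?_
    rw [Real.enorm_eq_ofReal_abs, ← ENNReal.ofReal_pow (abs_nonneg _),
      ← ENNReal.ofReal_mul (by positivity), pow_mul, sq_abs, mul_pow]
    congr 1
    ring
  simp_rw [hterm]
  rw [lintegral_tsum fun j => by fun_prop]
  set q := 8 * Real.exp 1 * d with hq'
  have hq0 : 0 ≤ q := by positivity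
  have hj : ∀ j : ℕ, ∫⁻ x, ENNReal.ofReal ((8 * π) ^ (j + 2) / (j + 2).factorial) *
        ‖v x‖ₑ ^ (2 * (j + 2)) ≤ ENNReal.ofReal (4 * π * q ^ 2 * q ^ j) := by
    intro j
    rw [lintegral_const_mul _ (by fun_prop)]
    grw [lintegral_enorm_pow_two_mul_le hv hs (by omega : 1 ≤ j + 2)]
    rw [hvd, ← ENNReal.ofReal_mul (by positivity), ← ENNReal.ofReal_pow (by positivity),
      ← ENNReal.ofReal_mul (by positivity), ← ENNReal.ofReal_mul (by positivity)]
    refine ENNReal.ofReal_le_ofReal ?_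
    have he := Real.pow_div_factorial_le_exp (x := ((j + 2 : ℕ) : ℝ)) (by positivity) (j + 2)
    rw [← Real.exp_one_pow] at he
    calc _ = 4 * π * (8 * d) ^ (j + 2) * (((j + 2 : ℕ) : ℝ) ^ (j + 2) / (j + 2).factorial) := by
          rw [mul_pow, mul_pow, mul_pow, div_pow]
          field_simp
      _ ≤ 4 * π * (8 * d) ^ (j + 2) * Real.exp 1 ^ (j + 2) := by gcongr
      _ = _ := by rw [hq']; ring
  refine (ENNReal.tsum_le_tsum hj).trans ?_
  have hg := (hasSum_geometric_of_lt_one hq0 (by linarith)).mul_left (4 * π * q ^ 2)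
  rw [← ENNReal.ofReal_tsum_of_nonneg (fun j => by positivity) hg.summable, hg.tsum_eq]
  refine ENNReal.ofReal_le_ofReal ?_
  have h2 : (1 - q)⁻¹ ≤ 2 := by
    rw [inv_le_comm₀ (by linarith) two_pos]
    linarith
  calc _ ≤ 4 * π * q ^ 2 * 2 := by gcongr
    _ = _ := by ring

theorem sq_mul_exp_le {y : ℝ} (hy : 0 ≤ y) :
    y ^ 2 / 4 * Real.exp y ≤ Real.exp (2 * y) - 1 - 2 * y := by
  have h := Real.quadratic_le_exp_of_nonneg hy
  rw [two_mul y, Real.exp_add]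
  nlinarith [mul_le_mul h (by linarith : 1 + y + y ^ 2 / 4 ≤ Real.exp y - y ^ 2 / 4)
    (by positivity) (Real.exp_pos y).le, pow_nonneg hy 3, pow_nonneg hy 4]

theorem exists_abs_primF_le {f : ℝ → ℝ} (hodd : ∀ s : ℝ, f (-s) = - f s)
    (hf1 : ∃ C > 0, ∀ s : ℝ, |f s| ≤ C * Real.exp (4 * π * s ^ 2))
    (hf2 : Tendsto (fun s : ℝ => f s / s) (𝓝[≠] 0) (𝓝 0)) {ε : ℝ} (hε : 0 < ε) :
    ∃ C > 0, ∀ s, |primF f s| ≤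
      ε * s ^ 2 + C * (Real.exp (8 * π * s ^ 2) - 1 - 8 * π * s ^ 2) := by
  obtain ⟨C, hC, hfC⟩ := hf1
  have hf0 : f 0 = 0 := by have := hodd 0; rw [neg_zero] at this; linarith
  have hev := hf2.eventually (ball_mem_nhds (0 : ℝ) hε)
  rw [eventually_nhdsWithin_iff, Metric.eventually_nhds_iff] at hev
  obtain ⟨δ, hδ, hδf⟩ := hev
  have hsmall : ∀ t, |t| < δ → |f t| ≤ ε * |t| := by
    intro t ht
    rcases eq_or_ne t 0 with rfl | h0
    · simp [hf0]
    · have := hδf (by simpa using ht) h0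
      rw [dist_zero_right, Real.norm_eq_abs, abs_div, div_lt_iff₀ (abs_pos.2 h0)] at this
      exact this.le
  have habs : ∀ {s t : ℝ}, t ∈ uIoc 0 s → |t| ≤ |s| := by
    intro s t ht
    rcases mem_uIoc.1 ht with h | h
    · rw [abs_of_pos h.1, abs_of_pos (h.1.trans_le h.2)]; exact h.2
    · rw [abs_of_nonpos h.2, abs_of_nonpos (h.1.le.trans h.2)]; linarith [h.1]
  have hbase : ∀ s : ℝ, 4 * s ^ 4 * Real.exp (4 * π * s ^ 2) ≤
      Real.exp (8 * π * s ^ 2) - 1 - 8 * π * s ^ 2 := by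
    intro s
    have h := sq_mul_exp_le (y := 4 * π * s ^ 2) (by positivity)
    rw [show 2 * (4 * π * s ^ 2) = 8 * π * s ^ 2 by ring] at h
    refine le_trans ?_ h
    gcongr
    have : 1 ≤ π ^ 2 := one_le_pow₀ (by linarith [Real.pi_gt_three])
    nlinarith [mul_le_mul_of_nonneg_right this (by positivity : 0 ≤ s ^ 4)]
  refine ⟨C / δ ^ 3, by positivity, fun s => ?_⟩
  have hexp0 : 0 ≤ Real.exp (8 * π * s ^ 2) - 1 - 8 * π * s ^ 2 :=
    le_trans (by positivity) (hbase s)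
  by_cases hs : |s| < δ
  · have h := intervalIntegral.norm_integral_le_of_norm_le_const (a := 0) (b := s) (f := f)
      (C := ε * |s|) fun t ht =>
        (hsmall t ((habs ht).trans_lt hs)).trans (mul_le_mul_of_nonneg_left (habs ht) hε.le)
    rw [sub_zero, mul_assoc, ← sq, sq_abs] at h
    have : 0 ≤ C / δ ^ 3 * (Real.exp (8 * π * s ^ 2) - 1 - 8 * π * s ^ 2) := by positivity
    rw [primF]
    exact h.trans (by linarith)
  · push Not at hs
    have h := intervalIntegral.norm_integral_le_of_norm_le_const (a := 0) (b := s) (f := f)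
      (C := C * Real.exp (4 * π * s ^ 2)) fun t ht => (hfC t).trans (by
        have := sq_le_sq.2 (habs ht)
        gcongr)
    rw [sub_zero] at h
    have hs3 : δ ^ 3 * |s| ≤ s ^ 4 := by
      calc δ ^ 3 * |s| ≤ |s| ^ 3 * |s| := by gcongr
        _ = s ^ 4 := by rw [← pow_succ, Even.pow_abs (by decide)]
    have : C * Real.exp (4 * π * s ^ 2) * |s| ≤
        C / δ ^ 3 * (Real.exp (8 * π * s ^ 2) - 1 - 8 * π * s ^ 2) := by
      rw [div_mul_eq_mul_div, le_div_iff₀ (by positivity)]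
      calc _ = C * ((δ ^ 3 * |s|) * Real.exp (4 * π * s ^ 2)) := by ring
        _ ≤ C * (s ^ 4 * Real.exp (4 * π * s ^ 2)) := by gcongr
        _ ≤ _ := by
          have := hbase s
          have h0 : 0 ≤ s ^ 4 * Real.exp (4 * π * s ^ 2) := by positivity
          gcongr
          linarith
    rw [primF]
    exact h.trans (by nlinarith [sq_nonneg s])

theorem norm_gradient_eq_norm_fderiv {E : Type*} [NormedAddCommGroup E] [InnerProductSpace ℝ E]
    [CompleteSpace E] (u : E → ℝ) (x : E) : ‖gradient u x‖ = ‖fderiv ℝ u x‖ :=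
  LinearIsometryEquiv.norm_map _ _

/-- mountain pass geometry, part (a): under (f₁), (f₂) there are
`r, ρ > 0` with `I(u) ≥ ρ` whenever the Dirichlet norm of `u` equals `r`. -/
theorem mountain_pass_geometry_a
    (f : ℝ → ℝ) (hcont : Continuous f) (hodd : ∀ s : ℝ, f (-s) = - f s)
    (hf1 : ∃ C > 0, ∀ s : ℝ, |f s| ≤ C * Real.exp (4 * π * s ^ 2))
    (hf2 : Tendsto (fun s : ℝ => f s / s) (𝓝[≠] 0) (𝓝 0))
    (m : ℕ) (hm : 1 ≤ m) :
    ∃ r > 0, ∃ ρ > 0, ∀ u : EuclideanSpace ℝ (Fin 2) → ℝ,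
      ContDiff ℝ (⊤ : ℕ∞) u → HasCompactSupport u → tsupport u ⊆ sector m →
      (∫ x in sector m, ‖gradient u x‖ ^ 2) = r ^ 2 →
      ρ ≤ energy f m u := by
  obtain ⟨C, hC, hF⟩ := exists_abs_primF_le hodd hf1 hf2 (ε := 1 / 32) (by norm_num)
  set e := Real.exp 1 with he
  have he1 : 1 ≤ e := Real.one_le_exp zero_le_one
  set d : ℝ := 1 / (4096 * π * e ^ 2 * (C + 1)) with hd
  have hd0 : 0 < d := by positivity
  have hdeq : 4096 * π * e ^ 2 * (C + 1) * d = 1 := by rw [hd]; field_simp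
  have hπ := Real.pi_gt_three
  have hq : 8 * e * d ≤ 1 / 2 := by
    have : 1 ≤ π * e * (C + 1) :=
      one_le_mul_of_one_le_of_one_le (one_le_mul_of_one_le_of_one_le (by linarith) he1)
        (by linarith)
    nlinarith [mul_le_mul_of_nonneg_right this (by positivity : 0 ≤ e * d)]
  have hCd : C * (8 * π * (8 * e * d) ^ 2) ≤ d / 8 := by
    have : C * (8 * π * (8 * e * d) ^ 2) ≤ 4096 * π * e ^ 2 * (C + 1) * d * d / 8 := by
      have h0 : 0 ≤ π * e ^ 2 * d ^ 2 := by positivity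
      linarith
    rwa [hdeq, one_mul] at this
  refine ⟨√d, Real.sqrt_pos.2 hd0, d / 4, by positivity, fun u hu hc hts hgrad => ?_⟩
  rw [Real.sq_sqrt hd0.le] at hgrad
  have hv : ContDiff ℝ 1 u := hu.of_le (by exact_mod_cast le_top)
  have hvc := hv.continuous
  have hcd : Continuous (fderiv ℝ u) := hv.continuous_fderiv one_ne_zero
  have hball : tsupport u ⊆ ball 0 1 := fun x hx => (hts hx).1
  have hdir : ∫⁻ y, ‖fderiv ℝ u y‖ₑ ^ 2 = ENNReal.ofReal d := by
    simp_rw [norm_gradient_eq_norm_fderiv] at hgrad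
    have hcs : HasCompactSupport fun x => ‖fderiv ℝ u x‖ ^ 2 :=
      (hc.fderiv ℝ).comp_left (g := fun L => ‖L‖ ^ 2) (by simp)
    rw [setIntegral_eq_integral_of_forall_compl_eq_zero] at hgrad
    · rw [← hgrad, ofReal_integral_eq_lintegral_ofReal
        ((by fun_prop : Continuous fun x => ‖fderiv ℝ u x‖ ^ 2).integrable_of_hasCompactSupport hcs)
        (ae_of_all _ fun x => by positivity)]
      refine lintegral_congr fun x => ?_
      rw [ENNReal.ofReal_pow (norm_nonneg _), ofReal_norm]
    · intro x hx
      have : fderiv ℝ u x = 0 :=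
        Function.notMem_support.1 fun h => hx (hts (support_fderiv_subset ℝ h))
      simp [this]
  have hL2 : ∫⁻ x, ENNReal.ofReal (u x ^ 2) ≤ ENNReal.ofReal (4 * d) := by
    have h := lintegral_enorm_pow_two_mul_le hv hball le_rfl
    rw [hdir, pow_one, ← ENNReal.ofReal_mul (by positivity),
      ← ENNReal.ofReal_mul (by positivity)] at h
    refine (le_of_eq (lintegral_congr fun x => ?_)).trans (h.trans (le_of_eq ?_))
    · rw [Real.enorm_eq_ofReal_abs, ← ENNReal.ofReal_pow (abs_nonneg _), mul_one, sq_abs]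
    · congr 1
      push_cast
      field_simp
  have hexp := lintegral_exp_sub_one_sub_le hv hball hd0.le hdir hq
  have hint : ∫⁻ x in sector m, ENNReal.ofReal ‖primF f (u x)‖ ≤ ENNReal.ofReal (d / 4) := by
    calc ∫⁻ x in sector m, ENNReal.ofReal ‖primF f (u x)‖
        ≤ ∫⁻ x, ENNReal.ofReal ‖primF f (u x)‖ := setLIntegral_le_lintegral _ _
      _ ≤ ∫⁻ x, (ENNReal.ofReal (1 / 32) * ENNReal.ofReal (u x ^ 2) + ENNReal.ofReal C *
          ENNReal.ofReal (Real.exp (8 * π * u x ^ 2) - 1 - 8 * π * u x ^ 2)) := by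
        refine lintegral_mono fun x => ?_
        rw [← ENNReal.ofReal_mul (by norm_num), ← ENNReal.ofReal_mul hC.le]
        exact (ENNReal.ofReal_le_ofReal (hF (u x))).trans ENNReal.ofReal_add_le
      _ ≤ ENNReal.ofReal (1 / 32) * ENNReal.ofReal (4 * d) +
          ENNReal.ofReal C * ENNReal.ofReal (8 * π * (8 * e * d) ^ 2) := by
        rw [lintegral_add_left (by fun_prop), lintegral_const_mul _ (by fun_prop),
          lintegral_const_mul _ (by fun_prop)]
        gcongr
      _ ≤ ENNReal.ofReal (d / 4) := by
        rw [← ENNReal.ofReal_mul (by norm_num), ← ENNReal.ofReal_mul hC.le,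
          ← ENNReal.ofReal_add (by positivity) (by positivity)]
        exact ENNReal.ofReal_le_ofReal (by linarith)
  have hbound : ∫ x in sector m, primF f (u x) ≤ d / 4 :=
    ((Real.le_norm_self _).trans (norm_integral_le_lintegral_norm _)).trans
      (ENNReal.toReal_le_of_le_ofReal (by positivity) hint)
  rw [energy, hgrad]
  linarith
end

section
/- For each natural number n ≥ 2, let w̄_n : ℝ² → ℝ be the Moser function: w̄_n(x) = (1/√(2π))·√(log n) if ‖x‖ ≤ 1/n; w̄_n(x) = (1/√(2π))·log(1/‖x‖)/√(log n) if 1/n ≤ ‖x‖ ≤ 1; and w̄_n(x) = 0 if ‖x‖ ≥ 1. Then ∫_{{x ∈ ℝ² : ‖x‖ < 1}} exp(4π·w̄_n(x)²) dx = π + 2π·(log n)·∫₀¹ exp(2·(log n)·(s² − s)) ds. -/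
open MeasureTheory Real Filter Metric Set
open scoped Topology

/-- The Moser function `w̄_n` on `ℝ²`. -/
noncomputable def moser (n : ℕ) (x : EuclideanSpace ℝ (Fin 2)) : ℝ :=
  if ‖x‖ ≤ 1 / (n : ℝ) then (1 / Real.sqrt (2 * π)) * Real.sqrt (Real.log n)
  else if ‖x‖ ≤ 1 then (1 / Real.sqrt (2 * π)) * (Real.log (1 / ‖x‖) / Real.sqrt (Real.log n))
  else 0

/-- Polar coordinates for a radial function on the unit disk. -/
theorem integral_ball_fun_norm (g : ℝ → ℝ) :
    (∫ x in ball (0 : EuclideanSpace ℝ (Fin 2)) 1, g ‖x‖) = 2 * π * ∫ r in (0:ℝ)..1, r * g r := by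
  have hball : volume.real (ball (0 : EuclideanSpace ℝ (Fin 2)) 1) = π := by
    simp [Measure.real, InnerProductSpace.volume_ball_of_dim_even (k := 1), pi_pos.le]
  have hind : (ball (0 : EuclideanSpace ℝ (Fin 2)) 1).indicator (fun x => g ‖x‖)
      = fun x => (Iio (1:ℝ)).indicator g ‖x‖ := by
    ext x
    simp [indicator]
  rw [← integral_indicator measurableSet_ball, hind, integral_fun_norm_addHaar volume, hball]
  have hmul : (fun r : ℝ => r ^ (Module.finrank ℝ (EuclideanSpace ℝ (Fin 2)) - 1) •
      (Iio (1:ℝ)).indicator g r) = (Iio (1:ℝ)).indicator (fun r => r * g r) := by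
    ext r
    by_cases h : r < 1 <;> simp [indicator, h]
  rw [hmul, setIntegral_indicator measurableSet_Iio, Ioi_inter_Iio,
    intervalIntegral.integral_of_le zero_le_one, integral_Ioc_eq_integral_Ioo]
  simp [mul_assoc]

/-- The substitution `r = exp (-L s)` in the integral over the annulus. -/
theorem integral_annulus_eq {L : ℝ} (hL : L ≠ 0) :
    (∫ r in Real.exp (-L)..1, r * Real.exp (2 * Real.log r ^ 2 / L))
      = L * ∫ s in (0:ℝ)..1, Real.exp (2 * L * (s ^ 2 - s)) := by
  have key := intervalIntegral.integral_comp_mul_deriv' (a := 0) (b := 1)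
    (f := fun s : ℝ => Real.exp (-L * s)) (f' := fun s => Real.exp (-L * s) * -L)
    (g := fun r => r * Real.exp (2 * Real.log r ^ 2 / L))
    (fun s _ => by simpa using ((hasDerivAt_id s).const_mul (-L)).exp) (by fun_prop) (by
      have hlog : ContinuousOn Real.log ((fun s : ℝ => Real.exp (-L * s)) '' uIcc 0 1) := by
        refine continuousOn_log.mono ?_
        rintro _ ⟨s, -, rfl⟩
        exact (Real.exp_pos _).ne'
      exact continuousOn_id.mul (((hlog.pow 2).const_mul 2).div_const L).rexp)
  simp only [mul_zero, Real.exp_zero, mul_one] at key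
  rw [intervalIntegral.integral_symm, ← key, ← intervalIntegral.integral_neg,
    ← intervalIntegral.integral_const_mul]
  refine intervalIntegral.integral_congr fun s _ => ?_
  have hexp : Real.exp (2 * L * (s ^ 2 - s)) =
      Real.exp (-L * s) * Real.exp (2 * (-L * s) ^ 2 / L) * Real.exp (-L * s) := by
    rw [← Real.exp_add, ← Real.exp_add]
    congr 1
    field_simp
    ring
  simp only [Function.comp_apply, Real.log_exp, hexp]
  ring

/-- The radial profile of `exp (4π w̄_n²)`. -/
noncomputable def moserExpProfile (n : ℕ) (r : ℝ) : ℝ :=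
  if r ≤ 1 / (n : ℝ) then (n : ℝ) ^ 2 else Real.exp (2 * Real.log r ^ 2 / Real.log n)

theorem exp_moser_sq_eq_profile {n : ℕ} (hn : 2 ≤ n) {x : EuclideanSpace ℝ (Fin 2)}
    (hx : ‖x‖ ≤ 1) : Real.exp (4 * π * (moser n x) ^ 2) = moserExpProfile n ‖x‖ := by
  have hn0 : (0:ℝ) < n := by positivity
  have hL : 0 < Real.log n := Real.log_pos (by exact_mod_cast hn)
  have hpi := pi_pos
  unfold moser moserExpProfile
  split_ifs
  · rw [mul_pow, div_pow, Real.sq_sqrt (by positivity), Real.sq_sqrt hL.le,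
      show 4 * π * (1 ^ 2 / (2 * π) * Real.log n) = (2 : ℕ) * Real.log n by
        push_cast; field_simp; ring, Real.exp_nat_mul, Real.exp_log hn0]
  · rw [mul_pow, div_pow, div_pow, Real.sq_sqrt (by positivity), Real.sq_sqrt hL.le, one_div ‖x‖,
      Real.log_inv]
    congr 1
    field_simp
    ring

theorem integral_mul_moserExpProfile {n : ℕ} (hn : 2 ≤ n) :
    (∫ r in (0:ℝ)..1, r * moserExpProfile n r)
      = 1 / 2 + Real.log n * ∫ s in (0:ℝ)..1, Real.exp (2 * Real.log n * (s ^ 2 - s)) := by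
  have hn0 : (0:ℝ) < n := by positivity
  have hL : 0 < Real.log n := Real.log_pos (by exact_mod_cast hn)
  have hinv : Real.exp (-Real.log n) = 1 / (n : ℝ) := by
    rw [Real.exp_neg, Real.exp_log hn0, one_div]
  have hinv0 : (0:ℝ) < 1 / n := by positivity
  have hinv1 : 1 / (n : ℝ) ≤ 1 := by
    rw [div_le_one hn0]
    exact_mod_cast (by omega : 1 ≤ n)
  have hin : EqOn (fun r => r * (n : ℝ) ^ 2) (fun r => r * moserExpProfile n r)
      (uIoc 0 (1 / (n : ℝ))) := by
    intro r hr
    rw [uIoc_of_le hinv0.le] at hr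
    simp only [moserExpProfile, if_pos hr.2]
  have hout : EqOn (fun r => r * Real.exp (2 * Real.log r ^ 2 / Real.log n))
      (fun r => r * moserExpProfile n r) (uIoc (1 / (n : ℝ)) 1) := by
    intro r hr
    rw [uIoc_of_le hinv1] at hr
    simp only [moserExpProfile, if_neg hr.1.not_ge]
  have hint₁ : IntervalIntegrable (fun r => r * moserExpProfile n r) volume 0 (1 / (n : ℝ)) :=
    IntervalIntegrable.congr hin (Continuous.intervalIntegrable (by fun_prop) _ _)
  have hint₂ : IntervalIntegrable (fun r => r * moserExpProfile n r) volume (1 / (n : ℝ)) 1 := by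
    refine IntervalIntegrable.congr hout (ContinuousOn.intervalIntegrable ?_)
    have hlog : ContinuousOn Real.log (uIcc (1 / (n : ℝ)) 1) := by
      refine continuousOn_log.mono fun r hr => ?_
      rw [uIcc_of_le hinv1] at hr
      exact (hinv0.trans_le hr.1).ne'
    exact continuousOn_id.mul (((hlog.pow 2).const_mul 2).div_const _).rexp
  rw [← intervalIntegral.integral_add_adjacent_intervals hint₁ hint₂,
    ← intervalIntegral.integral_congr_ae (.of_forall hin), ← intervalIntegral.integral_congr_ae (.of_forall hout),
    ← integral_annulus_eq hL.ne', hinv, intervalIntegral.integral_mul_const, integral_id]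
  congr 1
  field_simp
  ring

/-- `∫_B exp(4π w̄_n²) = π + 2π (log n) ∫₀¹ exp(2 (log n)(s² − s)) ds`. -/
theorem moser_exp_integral (n : ℕ) (hn : 2 ≤ n) :
    (∫ x in ball (0 : EuclideanSpace ℝ (Fin 2)) 1, Real.exp (4 * π * (moser n x) ^ 2))
      = π + 2 * π * Real.log n * ∫ s in (0:ℝ)..1, Real.exp (2 * Real.log n * (s ^ 2 - s)) := by
  rw [setIntegral_congr_fun measurableSet_ball fun x hx =>
      exp_moser_sq_eq_profile hn (mem_ball_zero_iff.mp hx).le,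
    integral_ball_fun_norm, integral_mul_moserExpProfile hn]
  ring
end

section
/- As n → ∞ (n ranging over natural numbers with n ≥ 2), the quantity 2·(log n)·∫₀¹ exp(2·(log n)·(s² − s)) ds converges to 2. -/
open MeasureTheory Real Filter
open scoped Topology

/-- Integration by parts against `(2s - 1) exp(a (s² - s))`. -/
theorem mul_integral_exp_mul_sq_sub (a : ℝ) :
    a * ∫ s in (0:ℝ)..1, exp (a * (s ^ 2 - s)) =
      2 + ∫ s in (0:ℝ)..1, (4 * (a * (s - s ^ 2)) - 2) * exp (-(a * (s - s ^ 2))) := by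
  have hderiv (s : ℝ) : HasDerivAt (fun s : ℝ => (2 * s - 1) * exp (a * (s ^ 2 - s)))
      (a * exp (a * (s ^ 2 - s)) -
        (4 * (a * (s - s ^ 2)) - 2) * exp (-(a * (s - s ^ 2)))) s := by
    have h₁ : HasDerivAt (fun s : ℝ => 2 * s - 1) 2 s := by
      simpa using ((hasDerivAt_id s).const_mul 2).sub_const 1
    have h₂ : HasDerivAt (fun s : ℝ => a * (s ^ 2 - s)) (a * (2 * s - 1)) s := by
      simpa using ((hasDerivAt_pow 2 s).sub (hasDerivAt_id s)).const_mul a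
    refine (h₁.mul h₂.exp).congr_deriv ?_
    rw [show -(a * (s - s ^ 2)) = a * (s ^ 2 - s) by ring]
    ring
  have hftc := intervalIntegral.integral_eq_sub_of_hasDerivAt (a := 0) (b := 1)
    (fun s _ => hderiv s) (Continuous.intervalIntegrable (by fun_prop) _ _)
  rw [intervalIntegral.integral_sub (Continuous.intervalIntegrable (by fun_prop) _ _)
    (Continuous.intervalIntegrable (by fun_prop) _ _), intervalIntegral.integral_const_mul] at hftc
  norm_num at hftc
  linarith

theorem abs_four_mul_sub_two_mul_exp_neg_le {x : ℝ} (hx : 0 ≤ x) :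
    |(4 * x - 2) * exp (-x)| ≤ 4 := by
  rw [abs_mul, abs_of_pos (exp_pos _), exp_neg, ← div_eq_mul_inv, div_le_iff₀ (exp_pos _), abs_le]
  constructor <;> linarith [add_one_le_exp x]

theorem tendsto_four_mul_sub_two_mul_exp_neg :
    Tendsto (fun x : ℝ => (4 * x - 2) * exp (-x)) atTop (𝓝 0) := by
  have h₁ := (tendsto_pow_mul_exp_neg_atTop_nhds_zero 1).const_mul 4
  have h₂ := tendsto_exp_neg_atTop_nhds_zero.const_mul 2
  convert h₁.sub h₂ using 2 <;> ring

theorem tendsto_mul_integral_exp_mul_sq_sub :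
    Tendsto (fun a : ℝ => a * ∫ s in (0:ℝ)..1, exp (a * (s ^ 2 - s))) atTop (𝓝 2) := by
  simp_rw [mul_integral_exp_mul_sq_sub]
  suffices h : Tendsto (fun a : ℝ => ∫ s in (0:ℝ)..1,
      (4 * (a * (s - s ^ 2)) - 2) * exp (-(a * (s - s ^ 2)))) atTop
      (𝓝 (∫ _ in (0:ℝ)..1, (0:ℝ))) by
    simpa using h.const_add 2
  refine intervalIntegral.tendsto_integral_filter_of_dominated_convergence (fun _ => 4)
    (Eventually.of_forall fun a => Continuous.aestronglyMeasurable (by fun_prop)) ?_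
    intervalIntegrable_const ?_
  · filter_upwards [eventually_ge_atTop 0] with a ha
    refine Eventually.of_forall fun s hs => ?_
    rw [Set.uIoc_of_le zero_le_one] at hs
    exact abs_four_mul_sub_two_mul_exp_neg_le (mul_nonneg ha (by nlinarith [hs.1, hs.2]))
  · filter_upwards [Measure.ae_ne volume (1:ℝ)] with s hs_ne hs
    rw [Set.uIoc_of_le zero_le_one] at hs
    have hs_lt : s < 1 := lt_of_le_of_ne hs.2 hs_ne
    exact tendsto_four_mul_sub_two_mul_exp_neg.comp
      (tendsto_id.atTop_mul_const (by nlinarith [hs.1]))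

/-- `2 (log n) ∫₀¹ exp(2 (log n)(s² − s)) ds → 2` as `n → ∞`. -/
theorem laplace_type_limit :
    Tendsto (fun n : ℕ =>
        2 * Real.log n * ∫ s in (0:ℝ)..1, Real.exp (2 * Real.log n * (s ^ 2 - s)))
      atTop (𝓝 2) := by
  exact tendsto_mul_integral_exp_mul_sq_sub.comp
    ((tendsto_log_atTop.comp tendsto_natCast_atTop_atTop).const_mul_atTop two_pos)
end

section
/- For each natural number n ≥ 2, let w̄_n : ℝ² → ℝ be the Moser function: w̄_n(x) = (1/√(2π))·√(log n) if ‖x‖ ≤ 1/n; w̄_n(x) = (1/√(2π))·log(1/‖x‖)/√(log n) if 1/n ≤ ‖x‖ ≤ 1; and w̄_n(x) = 0 if ‖x‖ ≥ 1. Then lim_{n→∞} ∫_{{x ∈ ℝ² : ‖x‖ < 1}} exp(4π·w̄_n(x)²) dx = 3π. -/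
open MeasureTheory Real Filter Metric Set
open scoped Topology

/-- Reflection `t ↦ 2 * L - t` folds the integral onto `[0, L]`. -/
lemma integral_exp_sq_div_sub_eq_two_mul {L : ℝ} (hL : 0 < L) :
    ∫ t in (0 : ℝ)..(2 * L), Real.exp (t ^ 2 / (2 * L) - t) =
      2 * ∫ t in (0 : ℝ)..L, Real.exp (t ^ 2 / (2 * L) - t) := by
  have hint : ∀ a b : ℝ, IntervalIntegrable (fun t : ℝ => Real.exp (t ^ 2 / (2 * L) - t))
      volume a b := fun a b => Continuous.intervalIntegrable (by fun_prop) a b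
  have hrefl : ∫ t in L..(2 * L), Real.exp (t ^ 2 / (2 * L) - t) =
      ∫ t in (0 : ℝ)..L, Real.exp (t ^ 2 / (2 * L) - t) := by
    have h := intervalIntegral.integral_comp_sub_left
      (fun t : ℝ => Real.exp (t ^ 2 / (2 * L) - t)) (a := 0) (b := L) (2 * L)
    rw [show 2 * L - L = L by ring, sub_zero] at h
    rw [← h]
    congr 1
    ext t
    congr 1
    field_simp
    ring
  rw [← intervalIntegral.integral_add_adjacent_intervals (hint 0 L) (hint L (2 * L)), hrefl]
  ring

lemma tendsto_integral_exp_sq_div_sub_half :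
    Tendsto (fun L : ℝ => ∫ t in (0 : ℝ)..L, Real.exp (t ^ 2 / (2 * L) - t)) atTop (𝓝 1) := by
  have hlim : Tendsto (fun L : ℝ => ∫ t in Ioi (0 : ℝ),
      (Iic L).indicator (fun t => Real.exp (t ^ 2 / (2 * L) - t)) t) atTop
      (𝓝 (∫ t in Ioi (0 : ℝ), Real.exp (-t))) := by
    refine tendsto_integral_filter_of_dominated_convergence
      (fun t => Real.exp (-(1 / 2) * t)) ?_ ?_ ?_ ?_
    · refine Eventually.of_forall fun L => ?_
      exact ((by fun_prop : Measurable fun t : ℝ => Real.exp (t ^ 2 / (2 * L) - t)).indicator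
        measurableSet_Iic).aestronglyMeasurable
    · filter_upwards [eventually_gt_atTop 0] with L hL
      filter_upwards [ae_restrict_mem measurableSet_Ioi] with t ht
      have ht0 : 0 < t := ht
      by_cases htL : t ≤ L
      · rw [indicator_of_mem (by exact htL), Real.norm_eq_abs, Real.abs_exp, Real.exp_le_exp]
        have : t ^ 2 / (2 * L) ≤ t / 2 := by
          rw [div_le_div_iff₀ (by positivity) (by positivity)]
          nlinarith
        linarith
      · rw [indicator_of_notMem (by exact htL), norm_zero]
        positivity
    · exact exp_neg_integrableOn_Ioi 0 (by norm_num)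
    · refine ae_of_all _ fun t => ?_
      have h1 : Tendsto (fun L : ℝ => Real.exp (t ^ 2 / (2 * L) - t)) atTop (𝓝 (Real.exp (-t))) := by
        refine (Real.continuous_exp.tendsto _).comp ?_
        have h2 : Tendsto (fun L : ℝ => 2 * L) atTop atTop :=
          tendsto_id.const_mul_atTop (by norm_num)
        simpa using (h2.const_div_atTop (t ^ 2)).sub_const t
      refine h1.congr' ?_
      filter_upwards [eventually_ge_atTop t] with L hL
      rw [indicator_of_mem (by exact hL)]
  rw [integral_exp_neg_Ioi_zero] at hlim
  refine hlim.congr' ?_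
  filter_upwards [eventually_gt_atTop 0] with L hL
  rw [setIntegral_indicator measurableSet_Iic, Ioi_inter_Iic,
    intervalIntegral.integral_of_le hL.le]

lemma tendsto_integral_exp_sq_div_sub :
    Tendsto (fun L : ℝ => ∫ t in (0 : ℝ)..(2 * L), Real.exp (t ^ 2 / (2 * L) - t))
      atTop (𝓝 2) := by
  have h := tendsto_integral_exp_sq_div_sub_half.const_mul 2
  rw [mul_one] at h
  refine h.congr' ?_
  filter_upwards [eventually_gt_atTop 0] with L hL
  exact (integral_exp_sq_div_sub_eq_two_mul hL).symm

/-- The substitution `y = exp (-t / 2)`. -/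
lemma integral_mul_exp_log_sq {L : ℝ} (hL : 0 < L) :
    ∫ y in (Real.exp (-L))..1, y * Real.exp (2 * Real.log y ^ 2 / L) =
      (1 / 2) * ∫ t in (0 : ℝ)..(2 * L), Real.exp (t ^ 2 / (2 * L) - t) := by
  have h := intervalIntegral.integral_comp_mul_deriv' (a := 0) (b := 2 * L)
    (f := fun t => Real.exp (-t / 2)) (f' := fun t => Real.exp (-t / 2) * (-1 / 2))
    (g := fun y => y * Real.exp (2 * Real.log y ^ 2 / L))
    (fun t _ => ((hasDerivAt_neg t).div_const 2).exp)
    (by fun_prop)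
    (by
      rintro y ⟨t, -, rfl⟩
      have h0 : Real.exp (-t / 2) ≠ 0 := (Real.exp_pos _).ne'
      exact ContinuousAt.continuousWithinAt (by fun_prop (disch := exact h0)))
  rw [show -(2 * L) / 2 = -L by ring, show -(0 : ℝ) / 2 = 0 by ring, Real.exp_zero] at h
  rw [intervalIntegral.integral_symm, ← h, ← intervalIntegral.integral_neg,
    ← intervalIntegral.integral_const_mul]
  congr 1
  ext t
  simp only [Function.comp_apply, Real.log_exp]
  have : t ^ 2 / (2 * L) - t = -t / 2 + 2 * (-t / 2) ^ 2 / L + -t / 2 := by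
    field_simp
    ring
  rw [this, Real.exp_add, Real.exp_add]
  ring

/-- The radial profile of `exp (4π w̄_n²)`, in terms of `L = log n`. -/
lemma exp_moser_sq {n : ℕ} (hn : 2 ≤ n) {x : EuclideanSpace ℝ (Fin 2)} (hx : ‖x‖ ≤ 1) :
    Real.exp (4 * π * moser n x ^ 2) =
      if ‖x‖ ≤ 1 / (n : ℝ) then (n : ℝ) ^ 2
      else Real.exp (2 * Real.log ‖x‖ ^ 2 / Real.log n) := by
  have hn1 : (1 : ℝ) < n := by exact_mod_cast hn
  have hL : 0 < Real.log n := Real.log_pos hn1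
  have hπ := Real.pi_pos
  unfold moser
  split_ifs with h
  · rw [mul_pow, div_pow, Real.sq_sqrt (by positivity), Real.sq_sqrt hL.le,
      show 4 * π * (1 ^ 2 / (2 * π) * Real.log n) = Real.log n + Real.log n by field_simp; ring,
      Real.exp_add, Real.exp_log (by linarith)]
    ring
  · rw [mul_pow, div_pow, div_pow, Real.sq_sqrt (by positivity), Real.sq_sqrt hL.le, one_div ‖x‖,
      Real.log_inv]
    congr 1
    field_simp
    ring

lemma integral_exp_moser_sq {n : ℕ} (hn : 2 ≤ n) :
    ∫ x in ball (0 : EuclideanSpace ℝ (Fin 2)) 1, Real.exp (4 * π * moser n x ^ 2) =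
      π + π * ∫ t in (0 : ℝ)..(2 * Real.log n),
        Real.exp (t ^ 2 / (2 * Real.log n) - t) := by
  have hn1 : (1 : ℝ) < n := by exact_mod_cast hn
  have hn0 : (0 : ℝ) < n := by linarith
  have hL : 0 < Real.log n := Real.log_pos hn1
  have hinv : (1 : ℝ) / n ≤ 1 := by rw [div_le_one hn0]; exact hn1.le
  have hinv0 : (0 : ℝ) < 1 / n := by positivity
  have hexp : Real.exp (-Real.log n) = 1 / n := by
    rw [Real.exp_neg, Real.exp_log hn0, one_div]
  set g : ℝ → ℝ := fun r => if r ≤ 1 / (n : ℝ) then (n : ℝ) ^ 2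
      else Real.exp (2 * Real.log r ^ 2 / Real.log n) with hg
  have hball : ∫ x in ball (0 : EuclideanSpace ℝ (Fin 2)) 1, Real.exp (4 * π * moser n x ^ 2) =
      ∫ x : EuclideanSpace ℝ (Fin 2), (Iio (1 : ℝ)).indicator g ‖x‖ := by
    rw [← integral_indicator measurableSet_ball]
    congr 1
    ext x
    by_cases hx : ‖x‖ < 1
    · rw [indicator_of_mem (by simpa using hx), indicator_of_mem (by exact hx),
        exp_moser_sq hn hx.le]
    · rw [indicator_of_notMem (by simpa using hx), indicator_of_notMem (by exact hx)]
  have hinner : ∫ y in (0 : ℝ)..(1 / n), y * g y = 1 / 2 := by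
    have : ∫ y in (0 : ℝ)..(1 / n), y * g y = ∫ y in (0 : ℝ)..(1 / n), y * (n : ℝ) ^ 2 := by
      refine intervalIntegral.integral_congr fun y hy => ?_
      rw [uIcc_of_le hinv0.le] at hy
      simp only [hg, if_pos hy.2]
    rw [this, intervalIntegral.integral_mul_const, integral_id]
    field_simp
    ring
  have hEqOn : EqOn (fun y => y * Real.exp (2 * Real.log y ^ 2 / Real.log n))
      (fun y => y * g y) (uIoc (1 / (n : ℝ)) 1) := by
    intro y hy
    rw [uIoc_of_le hinv] at hy
    simp only [hg, if_neg hy.1.not_ge]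
  have houter : ∫ y in (1 / (n : ℝ))..1, y * g y =
      (1 / 2) * ∫ t in (0 : ℝ)..(2 * Real.log n), Real.exp (t ^ 2 / (2 * Real.log n) - t) := by
    rw [← integral_mul_exp_log_sq hL, hexp]
    rw [uIoc_of_le hinv] at hEqOn
    rw [intervalIntegral.integral_of_le hinv, intervalIntegral.integral_of_le hinv]
    exact (setIntegral_congr_fun measurableSet_Ioc hEqOn).symm
  have hint1 : IntervalIntegrable (fun y => y * g y) volume 0 (1 / n) := by
    refine (Continuous.intervalIntegrable (by fun_prop : Continuous fun y : ℝ => y * (n : ℝ) ^ 2)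
      0 (1 / (n : ℝ))).congr fun y hy => ?_
    rw [uIoc_of_le hinv0.le] at hy
    simp only [hg, if_pos hy.2]
  have hint2 : IntervalIntegrable (fun y => y * g y) volume (1 / n) 1 := by
    refine (ContinuousOn.intervalIntegrable fun y hy => ?_).congr hEqOn
    rw [uIcc_of_le hinv] at hy
    have h0 : y ≠ 0 := (hinv0.trans_le hy.1).ne'
    exact ContinuousAt.continuousWithinAt (by fun_prop (disch := exact h0))
  have hradial : ∫ y in Ioi (0 : ℝ), y ^ (2 - 1) • (Iio (1 : ℝ)).indicator g y =
      ∫ y in (0 : ℝ)..1, y * g y := by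
    rw [intervalIntegral.integral_of_le zero_le_one, integral_Ioc_eq_integral_Ioo,
      ← Ioi_inter_Iio, ← setIntegral_indicator measurableSet_Iio]
    congr 1
    ext y
    by_cases hy : y ∈ Iio (1 : ℝ) <;> simp only [hy, not_false_eq_true, indicator_of_mem,
      indicator_of_notMem] <;> simp
  rw [hball, integral_fun_norm_addHaar, finrank_euclideanSpace_fin, hradial,
    ← intervalIntegral.integral_add_adjacent_intervals hint1 hint2, hinner, houter,
    measureReal_def, EuclideanSpace.volume_ball_fin_two, ENNReal.ofReal_one,
    one_pow, one_mul, ENNReal.toReal_ofReal Real.pi_pos.le, nsmul_eq_mul, smul_eq_mul]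
  push_cast
  ring

/-- `∫_B exp(4π w̄_n²) → 3π` as `n → ∞`. -/
theorem moser_exp_integral_limit :
    Tendsto (fun n : ℕ =>
        ∫ x in ball (0 : EuclideanSpace ℝ (Fin 2)) 1, Real.exp (4 * π * (moser n x) ^ 2))
      atTop (𝓝 (3 * π)) := by
  have hlog : Tendsto (fun n : ℕ => Real.log n) atTop atTop :=
    Real.tendsto_log_atTop.comp tendsto_natCast_atTop_atTop
  have h := ((tendsto_integral_exp_sq_div_sub.comp hlog).const_mul π).const_add π
  rw [show π + π * 2 = 3 * π by ring] at h
  refine h.congr' ?_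
  filter_upwards [eventually_ge_atTop 2] with n hn
  exact (integral_exp_moser_sq hn).symm
end

section
/- Let f : ℝ → ℝ be a continuous odd function satisfying: (f₁) there is C > 0 with |f(s)| ≤ C·exp(4π s²) for all s ∈ ℝ; (f₂) lim_{s→0} f(s)/s = 0; (H₁) there are s₀ > 0 and M > 0 such that 0 < F(s) ≤ M|f(s)| for all |s| ≥ s₀, where F(s) = ∫₀^s f(t) dt; (H₂) 0 < F(s) ≤ (1/2) f(s) s for all s ≠ 0; (H₃) lim_{s→+∞} s f(s) exp(−4π s²) = +∞. Fix x₀ ∈ ℝ² and d > 0, and for n ≥ 2 set w_n(x) = w̄_n((x − x₀)/d), where w̄_n is the Moser function. Then there exists n ≥ 2 such that sup_{t ≥ 0} ( t²/2 − ∫_{{x : ‖x − x₀‖ < d}} F(t·w_n(x)) dx ) < 1/2. -/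
open MeasureTheory Real Filter Metric Set
open scoped Topology

theorem primF_nonneg {f : ℝ → ℝ} (hpos : ∀ s : ℝ, s ≠ 0 → 0 < primF f s) (s : ℝ) :
    0 ≤ primF f s := by
  rcases eq_or_ne s 0 with rfl | hs
  · simp [primF]
  · exact (hpos s hs).le

theorem continuous_primF {f : ℝ → ℝ} (hf : Continuous f) : Continuous (primF f) :=
  intervalIntegral.continuous_primitive (fun a b => hf.intervalIntegrable a b) 0

/-- If `s f(s) exp(-4πs²) → ∞`, then `F(s)` eventually dominates any multiple of
`exp(4πs²) / s²`. -/
theorem eventually_le_primF {f : ℝ → ℝ} (hf : Continuous f)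
    (hnonneg : ∀ s : ℝ, 0 ≤ primF f s)
    (h : Tendsto (fun s : ℝ => s * f s * Real.exp (-(4 * π * s ^ 2))) atTop atTop) (K : ℝ)
    (hK : 0 < K) : ∃ S > 0, ∀ s ≥ S, K * Real.exp (4 * π * s ^ 2) / s ^ 2 ≤ primF f s := by
  obtain ⟨S, hS⟩ := eventually_atTop.1 (h.eventually_ge_atTop (K * Real.exp (8 * π)))
  refine ⟨max S 1 + 1, by positivity, fun s hs => ?_⟩
  have hS1 : S ≤ max S 1 := le_max_left _ _
  have h11 : (1 : ℝ) ≤ max S 1 := le_max_right _ _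
  have hs2 : 2 ≤ s := by linarith
  have hs0 : 0 < s := by linarith
  have hinv : s⁻¹ ≤ 1 := inv_le_one_of_one_le₀ (by linarith)
  have hinv0 : 0 < s⁻¹ := inv_pos.2 hs0
  have hle : s - s⁻¹ ≤ s := by linarith
  have hbound : ∀ t ∈ Icc (s - s⁻¹) s, K * Real.exp (4 * π * s ^ 2) / s ≤ f t := by
    intro t ht
    have ht0 : 0 < t := by linarith [ht.1]
    have hKt := hS t (by linarith [ht.1])
    have hsq : s ^ 2 - 2 ≤ t ^ 2 := by
      have h2 : s * s⁻¹ = 1 := mul_inv_cancel₀ hs0.ne'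
      nlinarith [ht.1, ht.2]
    rw [Real.exp_neg, ← div_eq_mul_inv, le_div_iff₀ (Real.exp_pos _)] at hKt
    have hexp : Real.exp (4 * π * s ^ 2) ≤ Real.exp (8 * π) * Real.exp (4 * π * t ^ 2) := by
      rw [← Real.exp_add]
      apply Real.exp_le_exp.2
      nlinarith [Real.pi_pos]
    have hE : K * Real.exp (4 * π * s ^ 2) ≤ t * f t := by
      calc _ ≤ K * (Real.exp (8 * π) * Real.exp (4 * π * t ^ 2)) := by gcongr
        _ ≤ _ := by linarith
    have hft : 0 ≤ f t := by
      have : 0 < t * f t := lt_of_lt_of_le (by positivity) hE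
      exact (pos_of_mul_pos_right this ht0.le).le
    rw [div_le_iff₀ hs0]
    nlinarith [ht.2]
  have hint : (s - (s - s⁻¹)) * (K * Real.exp (4 * π * s ^ 2) / s) ≤ ∫ t in (s - s⁻¹)..s, f t := by
    have := intervalIntegral.integral_mono_on (μ := volume) hle
      (intervalIntegrable_const (c := K * Real.exp (4 * π * s ^ 2) / s))
      (hf.intervalIntegrable _ _) hbound
    rwa [intervalIntegral.integral_const, smul_eq_mul] at this
  have hadd : primF f (s - s⁻¹) + (∫ t in (s - s⁻¹)..s, f t) = primF f s :=
    intervalIntegral.integral_add_adjacent_intervals (hf.intervalIntegrable _ _)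
      (hf.intervalIntegrable _ _)
  have heq : (s - (s - s⁻¹)) * (K * Real.exp (4 * π * s ^ 2) / s)
      = K * Real.exp (4 * π * s ^ 2) / s ^ 2 := by
    field_simp
    ring
  linarith [hnonneg (s - s⁻¹)]

theorem measurable_moser (n : ℕ) : Measurable (moser n) := by
  unfold moser
  refine Measurable.ite (measurableSet_le measurable_norm measurable_const) measurable_const
    (Measurable.ite (measurableSet_le measurable_norm measurable_const) ?_ measurable_const)
  fun_prop

theorem moser_mem_Icc {n : ℕ} (hn : 2 ≤ n) (x : EuclideanSpace ℝ (Fin 2)) :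
    moser n x ∈ Icc 0 ((1 / Real.sqrt (2 * π)) * Real.sqrt (Real.log n)) := by
  have hn' : (2 : ℝ) ≤ n := by exact_mod_cast hn
  have hL : 0 < Real.log n := Real.log_pos (by linarith)
  unfold moser
  split_ifs with h1 h2
  · exact ⟨by positivity, le_rfl⟩
  · have hx : 0 < ‖x‖ := lt_trans (by positivity) (not_le.1 h1)
    have hlog0 : 0 ≤ Real.log (1 / ‖x‖) := Real.log_nonneg ((one_le_div hx).2 h2)
    refine ⟨by positivity, ?_⟩
    gcongr
    rw [div_le_iff₀ (Real.sqrt_pos.2 hL), Real.mul_self_sqrt hL.le]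
    apply Real.log_le_log (by positivity)
    rw [div_le_iff₀ hx]
    have := (not_le.1 h1).le
    rwa [div_le_iff₀' (by positivity)] at this
  · exact ⟨le_rfl, by positivity⟩

/-- The energy of `t w_n` is bounded below by the contribution of the ball where `w_n` is
constant. -/
theorem le_setIntegral_primF_moser {f : ℝ → ℝ} (hf : Continuous f)
    (hnonneg : ∀ s : ℝ, 0 ≤ primF f s) {n : ℕ} (hn : 2 ≤ n) (x₀ : EuclideanSpace ℝ (Fin 2))
    {d : ℝ} (hd : 0 < d) (t : ℝ) :
    π * (d / n) ^ 2 * primF f (t * ((1 / Real.sqrt (2 * π)) * Real.sqrt (Real.log n))) ≤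
      ∫ x in ball x₀ d, primF f (t * moser n (d⁻¹ • (x - x₀))) := by
  have hn' : (2 : ℝ) ≤ n := by exact_mod_cast hn
  set A := (1 / Real.sqrt (2 * π)) * Real.sqrt (Real.log n) with hA
  have hmeas : Measurable fun x : EuclideanSpace ℝ (Fin 2) =>
      primF f (t * moser n (d⁻¹ • (x - x₀))) :=
    (continuous_primF hf).measurable.comp
      (((measurable_moser n).comp (by fun_prop)).const_mul t)
  obtain ⟨C, hC⟩ := (isCompact_Icc (a := (0 : ℝ)) (b := A)).exists_bound_of_continuousOn
    (f := fun s => primF f (t * s))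
    ((continuous_primF hf).comp (continuous_const_mul t)).continuousOn
  have hint : IntegrableOn (fun x : EuclideanSpace ℝ (Fin 2) =>
      primF f (t * moser n (d⁻¹ • (x - x₀)))) (ball x₀ d) :=
    IntegrableOn.of_bound measure_ball_lt_top hmeas.aestronglyMeasurable C
      (Eventually.of_forall fun x => hC _ (moser_mem_Icc hn _))
  have hsub : ball x₀ (d / n) ⊆ ball x₀ d :=
    ball_subset_ball (div_le_self hd.le (by linarith))
  have hmono := setIntegral_mono_set hint (Eventually.of_forall fun x => hnonneg _)
    hsub.eventuallyLE
  have hcongr : ∫ x in ball x₀ (d / n), primF f (t * moser n (d⁻¹ • (x - x₀)))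
      = ∫ _ in ball x₀ (d / n), primF f (t * A) := by
    refine setIntegral_congr_fun measurableSet_ball fun x hx => ?_
    have hx' : ‖d⁻¹ • (x - x₀)‖ ≤ 1 / (n : ℝ) := by
      rw [norm_smul, Real.norm_of_nonneg (by positivity), inv_mul_le_iff₀ hd, mul_one_div]
      exact (mem_ball_iff_norm.1 hx).le
    simp only [moser, if_pos hx', hA]
  rw [hcongr, setIntegral_const, smul_eq_mul, Measure.real,
    EuclideanSpace.volume_ball_fin_two] at hmono
  refine le_of_eq_of_le ?_ hmono
  rw [ENNReal.toReal_mul, ENNReal.toReal_pow, ENNReal.toReal_ofReal (by positivity)]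
  rw [ENNReal.toReal_ofReal Real.pi_pos.le, mul_comm π]

theorem half_le_exp_div {L v : ℝ} (hL : 1 ≤ L) (hv : -1 < v) :
    (v + 1) / 2 * (1 + v / L) ≤ Real.exp 2 * Real.exp (2 * v) := by
  have h1 : v + 2 ≤ Real.exp (1 + v) := by linarith [Real.add_one_le_exp (1 + v)]
  have h2 : Real.exp 2 * Real.exp (2 * v) = Real.exp (1 + v) ^ 2 := by
    rw [← Real.exp_add, ← Real.exp_nat_mul]
    congr 1
    push_cast
    ring
  have h3 : 1 + v / L ≤ v + 2 := by
    have : v / L ≤ v + 1 := by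
      rw [div_le_iff₀ (by linarith)]
      nlinarith
    linarith
  rw [h2]
  nlinarith [mul_le_mul_of_nonneg_left h3 (by linarith : 0 ≤ (v + 1) / 2)]

/-- under (f₁), (f₂), (H₁), (H₂), (H₃), for the translated and rescaled
Moser functions `w_n(x) = w̄_n((x − x₀)/d)` there exists `n ≥ 2` such that
`sup_{t ≥ 0} ( t²/2 − ∫_{B_d(x₀)} F(t w_n) ) < 1/2`. -/
theorem mountain_pass_level_below_half
    (f : ℝ → ℝ) (hcont : Continuous f) (hodd : ∀ s : ℝ, f (-s) = - f s)
    (hf1 : ∃ C > 0, ∀ s : ℝ, |f s| ≤ C * Real.exp (4 * π * s ^ 2))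
    (hf2 : Tendsto (fun s : ℝ => f s / s) (𝓝[≠] 0) (𝓝 0))
    (hH1 : ∃ s₀ > 0, ∃ M > 0, ∀ s : ℝ, s₀ ≤ |s| → 0 < primF f s ∧ primF f s ≤ M * |f s|)
    (hH2 : ∀ s : ℝ, s ≠ 0 → 0 < primF f s ∧ primF f s ≤ (1/2) * f s * s)
    (hH3 : Tendsto (fun s : ℝ => s * f s * Real.exp (-(4 * π * s ^ 2))) atTop atTop)
    (x₀ : EuclideanSpace ℝ (Fin 2)) (d : ℝ) (hd : 0 < d) :
    ∃ n : ℕ, 2 ≤ n ∧ ∃ c : ℝ, c < 1/2 ∧ ∀ t : ℝ, 0 ≤ t →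
      t ^ 2 / 2 - (∫ x in ball x₀ d, primF f (t * moser n (d⁻¹ • (x - x₀)))) ≤ c := by
  have hnonneg := primF_nonneg fun s hs => (hH2 s hs).1
  obtain ⟨S, hS0, hS⟩ := eventually_le_primF hcont hnonneg hH3
    (Real.exp 2 / (2 * π ^ 2 * d ^ 2)) (by positivity)
  have hlog : Tendsto (fun n : ℕ => Real.log n) atTop atTop :=
    Real.tendsto_log_atTop.comp tendsto_natCast_atTop_atTop
  obtain ⟨n, hLS, hL2, hn⟩ := ((hlog.eventually_ge_atTop (4 * π * S ^ 2)).and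
    ((hlog.eventually_ge_atTop 2).and (eventually_ge_atTop 2))).exists
  have hn0 : (0 : ℝ) < n := by exact_mod_cast (by lia : 0 < n)
  set L := Real.log n with hL
  have hLpos : 0 < L := by linarith
  have hnexp : (n : ℝ) = Real.exp L := (Real.exp_log hn0).symm
  refine ⟨n, hn, 1 / 2 - 1 / (2 * L), by linarith [show 0 < 1 / (2 * L) by positivity],
    fun t ht => ?_⟩
  have hlow := le_setIntegral_primF_moser hcont hnonneg hn x₀ hd t
  set I := ∫ x in ball x₀ d, primF f (t * moser n (d⁻¹ • (x - x₀)))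
  rw [← hL] at hlow
  set s := t * (1 / Real.sqrt (2 * π) * Real.sqrt L) with hs
  obtain ⟨v, hv⟩ : ∃ v, v = (t ^ 2 - 1) * L := ⟨_, rfl⟩
  have htv : t ^ 2 = 1 + v / L := by
    rw [hv]
    field_simp
    ring
  have hgoal : t ^ 2 / 2 - (v + 1) / 2 / L = 1 / 2 - 1 / (2 * L) := by
    rw [htv]
    field_simp
    ring
  suffices h : (v + 1) / 2 / L ≤ I by linarith
  rcases le_or_gt v (-1) with hv1 | hv1
  · have hI : 0 ≤ I := le_trans (mul_nonneg (by positivity) (hnonneg s)) hlow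
    exact (div_nonpos_of_nonpos_of_nonneg (by linarith) hLpos.le).trans hI
  have ht2 : 1 / 2 ≤ t ^ 2 := by
    have : -(1 / 2) ≤ v / L := by
      rw [le_div_iff₀ hLpos]
      linarith
    linarith
  have hs2 : s ^ 2 = t ^ 2 * L / (2 * π) := by
    rw [hs, mul_pow, mul_pow, div_pow, Real.sq_sqrt hLpos.le, Real.sq_sqrt (by positivity)]
    ring
  have hsS : S ≤ s := by
    refine (sq_le_sq₀ hS0.le (by positivity)).1 ?_
    rw [hs2, le_div_iff₀ (by positivity)]
    nlinarith
  have hF := hS s hsS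
  have ht2pos : 0 < t ^ 2 := by linarith
  have hexp : Real.exp (4 * π * s ^ 2) = Real.exp (2 * v) * (n : ℝ) ^ 2 := by
    rw [hnexp, ← Real.exp_nat_mul, ← Real.exp_add, hs2, hv]
    congr 1
    push_cast
    field_simp
    ring
  rw [hexp, hs2] at hF
  have hkey := half_le_exp_div (by linarith : 1 ≤ L) hv1
  rw [← htv] at hkey
  calc (v + 1) / 2 / L ≤ Real.exp 2 * Real.exp (2 * v) / t ^ 2 / L := by
        refine div_le_div_of_nonneg_right ?_ hLpos.le
        rwa [le_div_iff₀ ht2pos]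
    _ = π * (d / n) ^ 2 * (Real.exp 2 / (2 * π ^ 2 * d ^ 2) * (Real.exp (2 * v) * (n : ℝ) ^ 2) /
          (t ^ 2 * L / (2 * π))) := by
        field_simp
    _ ≤ π * (d / n) ^ 2 * primF f s := by gcongr
    _ ≤ I := hlow
end
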